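/- With a, b, b*, b** as defined, for every α∈[0,1]: b**(α) = inf{E[b*(Z)] : Z a random variable with values in [0,1] and E[Z] ≤ α}. -/

import Mathlib

open MeasureTheory ProbabilityTheory Filter

namespace TwoGroup

/-- The two-group random mixture model: a σ-finite base measure on the sample space `𝒳`,
a null proportion `π0 ∈ (0,1)`, and null/non-null probability density functions `f0`, `f1`
with respect to the base measure. -/
structure Model (𝒳 : Type*) [MeasurableSpace 𝒳] where
  base : Measure 𝒳
  sigmaFinite : SigmaFinite base
  π0 : ℝ
  π0_mem : π0 ∈ Set.Ioo (0 : ℝ) 1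
  f0 : 𝒳 → ℝ
  f1 : 𝒳 → ℝ
  f0_meas : Measurable f0
  f1_meas : Measurable f1
  f0_nonneg : ∀ x, 0 ≤ f0 x
  f1_nonneg : ∀ x, 0 ≤ f1 x
  f0_prob : IsProbabilityMeasure (base.withDensity fun x => ENNReal.ofReal (f0 x))
  f1_prob : IsProbabilityMeasure (base.withDensity fun x => ENNReal.ofReal (f1 x))

namespace Model

variable {𝒳 : Type*} [MeasurableSpace 𝒳] (M : Model 𝒳)

/-- The non-null proportion `π1 = 1 - π0`. -/
noncomputable def π1 : ℝ := 1 - M.π0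

/-- The marginal density `f = π0 f0 + π1 f1`. -/
noncomputable def f (x : 𝒳) : ℝ := M.π0 * M.f0 x + M.π1 * M.f1 x

/-- The local false discovery rate `Lfdr(x) = π0 f0(x) / f(x)`. -/
noncomputable def Lfdr (x : 𝒳) : ℝ := M.π0 * M.f0 x / M.f x

/-- The joint law of a single pair `(θ, X)`; `true` encodes `θ = 1` (non-null). -/
noncomputable def joint : Measure (Bool × 𝒳) :=
  (ENNReal.ofReal M.π0) •
      ((Measure.dirac false).prod (M.base.withDensity fun x => ENNReal.ofReal (M.f0 x))) +
    (ENNReal.ofReal M.π1) •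
      ((Measure.dirac true).prod (M.base.withDensity fun x => ENNReal.ofReal (M.f1 x)))

/-- The joint law of `((θ1, X1), …, (θn, Xn))`: i.i.d. copies of `(θ, X)`. -/
noncomputable def jointN (n : ℕ) : Measure (Fin n → Bool × 𝒳) :=
  Measure.pi fun _ => M.joint

end Model

/-- Number of rejections `Σ_i δ_i`. -/
def nRej {n : ℕ} (d : Fin n → Bool) : ℝ := ∑ i, if d i then (1 : ℝ) else 0

/-- Number of false discoveries `Σ_i δ_i (1 - θ_i)`. -/
def nFD {n : ℕ} (θ d : Fin n → Bool) : ℝ :=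
  ∑ i, (if d i then (1 : ℝ) else 0) * (if θ i then (0 : ℝ) else 1)

/-- Number of acceptances `Σ_i (1 - δ_i)`. -/
def nAcc {n : ℕ} (d : Fin n → Bool) : ℝ := ∑ i, if d i then (0 : ℝ) else 1

/-- Number of false non-discoveries `Σ_i (1 - δ_i) θ_i`. -/
def nFN {n : ℕ} (θ d : Fin n → Bool) : ℝ :=
  ∑ i, (if d i then (0 : ℝ) else 1) * (if θ i then (1 : ℝ) else 0)

/-- False discovery proportion. -/
noncomputable def FDP {n : ℕ} (θ d : Fin n → Bool) : ℝ := nFD θ d / max 1 (nRej d)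

/-- False non-discovery proportion. -/
noncomputable def FNP {n : ℕ} (θ d : Fin n → Bool) : ℝ := nFN θ d / max 1 (nAcc d)

/-- A decision rule is a Markov kernel from `𝒳^n` to `{0,1}^n`: a measurable family of
probability measures on `Fin n → Bool`. -/
def IsRule {𝒳 : Type*} [MeasurableSpace 𝒳] {n : ℕ}
    (κ : (Fin n → 𝒳) → Measure (Fin n → Bool)) : Prop :=
  Measurable κ ∧ ∀ x, IsProbabilityMeasure (κ x)

namespace Model

variable {𝒳 : Type*} [MeasurableSpace 𝒳] (M : Model 𝒳)

/-- The false discovery rate `FDR = E[FDP]` of a (randomized) decision rule. -/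
noncomputable def FDR (n : ℕ) (κ : (Fin n → 𝒳) → Measure (Fin n → Bool)) : ℝ :=
  ∫ ω, ∫ d, FDP (fun i => (ω i).1) d ∂(κ fun i => (ω i).2) ∂(M.jointN n)

/-- The false non-discovery rate `FNR = E[FNP]` of a (randomized) decision rule. -/
noncomputable def FNR (n : ℕ) (κ : (Fin n → 𝒳) → Measure (Fin n → Bool)) : ℝ :=
  ∫ ω, ∫ d, FNP (fun i => (ω i).1) d ∂(κ fun i => (ω i).2) ∂(M.jointN n)

/-- The marginal FDR `mFDR = E[Σ δi (1-θi)] / E[Σ δi]` (with `0/0 = 0`). -/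
noncomputable def mFDR (n : ℕ) (κ : (Fin n → 𝒳) → Measure (Fin n → Bool)) : ℝ :=
  (∫ ω, ∫ d, nFD (fun i => (ω i).1) d ∂(κ fun i => (ω i).2) ∂(M.jointN n)) /
    (∫ ω, ∫ d, nRej d ∂(κ fun i => (ω i).2) ∂(M.jointN n))

/-- The marginal FNR `mFNR = E[Σ (1-δi) θi] / E[Σ (1-δi)]` (with `0/0 = 0`). -/
noncomputable def mFNR (n : ℕ) (κ : (Fin n → 𝒳) → Measure (Fin n → Bool)) : ℝ :=
  (∫ ω, ∫ d, nFN (fun i => (ω i).1) d ∂(κ fun i => (ω i).2) ∂(M.jointN n)) /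
    (∫ ω, ∫ d, nAcc d ∂(κ fun i => (ω i).2) ∂(M.jointN n))

/-- `FNR*_n(α)`: the minimum FNR over decision rules controlling FDR at level `α`. -/
noncomputable def FNRstar (n : ℕ) (α : ℝ) : ℝ :=
  sInf {r | ∃ κ : (Fin n → 𝒳) → Measure (Fin n → Bool),
    IsRule κ ∧ M.FDR n κ ≤ α ∧ r = M.FNR n κ}

/-- The minimum mFNR over decision rules for `n` hypotheses controlling mFDR at level `α`. -/
noncomputable def mFNRstarN (n : ℕ) (α : ℝ) : ℝ :=
  sInf {r | ∃ κ : (Fin n → 𝒳) → Measure (Fin n → Bool),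
    IsRule κ ∧ M.mFDR n κ ≤ α ∧ r = M.mFNR n κ}

/-- `mFNR*(α)` (this quantity does not depend on the number of hypotheses; we take `n = 1`). -/
noncomputable def mFNRstar (α : ℝ) : ℝ := M.mFNRstarN 1 α

/-- The marginal law of a single observation `X ∼ f`. -/
noncomputable def Pmix : Measure 𝒳 := M.base.withDensity fun x => ENNReal.ofReal (M.f x)

/-- The law of `W = Lfdr(X)`, `X ∼ f`. -/
noncomputable def νW : Measure ℝ := M.Pmix.map M.Lfdr

/-- `G(t) = P(W ≤ t)`. -/
noncomputable def G (t : ℝ) : ℝ := (M.νW (Set.Iic t)).toReal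

/-- `Ḡ(t) = P(W < t)`. -/
noncomputable def Gbar (t : ℝ) : ℝ := (M.νW (Set.Iio t)).toReal

/-- The generalized inverse `G^{-1}(u) = inf{t : G(t) ≥ u}`. -/
noncomputable def Ginv (u : ℝ) : ℝ := sInf {t | u ≤ M.G t}

/-- `P(W = t)`. -/
noncomputable def atom (t : ℝ) : ℝ := (M.νW {t}).toReal

/-- The randomization probability `p(u)`, satisfying
`Ḡ(G^{-1}(u)) + p(u) P(W = G^{-1}(u)) = u`. -/
noncomputable def pu (u : ℝ) : ℝ := (u - M.Gbar (M.Ginv u)) / M.atom (M.Ginv u)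

/-- `a(u) = E[W | S_u = 1]` for `u ∈ (0,1]`, `a(0) = 0`, where `S_u` is the Bernoulli(u)
thresholding variable of `W` at `G^{-1}(u)` with randomization `p(u)` at the boundary. -/
noncomputable def a (u : ℝ) : ℝ :=
  if u = 0 then 0
  else ((∫ w in Set.Iio (M.Ginv u), w ∂M.νW) + M.pu u * (M.Ginv u * M.atom (M.Ginv u))) / u

/-- `b(u) = E[1 - W | S_u = 0]` for `u ∈ [0,1)`, `b(1) = 0`. -/
noncomputable def b (u : ℝ) : ℝ :=
  if u = 1 then 0
  else ((∫ w in Set.Ioi (M.Ginv u), (1 - w) ∂M.νW)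
      + (1 - M.pu u) * ((1 - M.Ginv u) * M.atom (M.Ginv u))) / (1 - u)

/-- `b*(α) = inf{b(u) : u ∈ [0,1], a(u) ≤ α}`. -/
noncomputable def bstar (α : ℝ) : ℝ :=
  sInf {y | ∃ u ∈ Set.Icc (0 : ℝ) 1, M.a u ≤ α ∧ y = M.b u}

/-- `u*(α) = sup{u ∈ [0,1] : a(u) ≤ α}`. -/
noncomputable def ustar (α : ℝ) : ℝ :=
  sSup {u | u ∈ Set.Icc (0 : ℝ) 1 ∧ M.a u ≤ α}

/-- `b**(α) = inf{E[b(U)] : U a [0,1]-valued random variable with E[a(U)] ≤ α}`. -/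
noncomputable def bstarstar (α : ℝ) : ℝ :=
  sInf {y | ∃ ρ : Measure ℝ, IsProbabilityMeasure ρ ∧ (∀ᵐ u ∂ρ, u ∈ Set.Icc (0 : ℝ) 1) ∧
    (∫ u, M.a u ∂ρ) ≤ α ∧ y = ∫ u, M.b u ∂ρ}

end Model

/-- The Bernoulli(p) measure on `Bool`. -/
noncomputable def bern (p : ℝ) : Measure Bool :=
  (ENNReal.ofReal p) • Measure.dirac true + (ENNReal.ofReal (1 - p)) • Measure.dirac false

namespace Model

variable {𝒳 : Type*} [MeasurableSpace 𝒳] (M : Model 𝒳)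

/-- The per-observation rejection probability of the Neyman–Pearson rule at level `α`:
reject if `Lfdr(x) < G^{-1}(u*(α))`, randomize with probability `p(u*(α))` at equality,
and accept otherwise. -/
noncomputable def qNP (α : ℝ) (x : 𝒳) : ℝ :=
  if M.Lfdr x < M.Ginv (M.ustar α) then 1
  else if M.Lfdr x = M.Ginv (M.ustar α) then M.pu (M.ustar α)
  else 0

/-- The Neyman–Pearson rule `δ^n_NP(α)`, as a Markov kernel: independent randomized
likelihood-ratio tests applied to each observation. -/
noncomputable def NP (α : ℝ) (n : ℕ) : (Fin n → 𝒳) → Measure (Fin n → Bool) :=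
  fun x => Measure.pi fun i => bern (M.qNP α (x i))

/-- The probability (over data and the randomization of the rule `κ`) that the decision vector
lies in the set `E θ` (which may depend on the true labels `θ`). -/
noncomputable def prob (n : ℕ) (κ : (Fin n → 𝒳) → Measure (Fin n → Bool))
    (E : (Fin n → Bool) → Set (Fin n → Bool)) : ℝ :=
  (∫⁻ ω, κ (fun i => (ω i).2) (E fun i => (ω i).1) ∂(M.jointN n)).toReal

end Model

/-- `sortedVal n w i` is the `i`-th order statistic `w_(i)` (for `1 ≤ i ≤ n`) of
`w 0, …, w (n-1)`. -/
noncomputable def sortedVal (n : ℕ) (w : Fin n → ℝ) (i : ℕ) : ℝ :=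
  ((Multiset.map w Finset.univ.val).sort (· ≤ ·)).getD (i - 1) 0

/-- `avgLow n w k = (1/k) Σ_{i=1}^k w_(i)` (equal to `0` when `k = 0`). -/
noncomputable def avgLow (n : ℕ) (w : Fin n → ℝ) (k : ℕ) : ℝ :=
  (∑ i ∈ Finset.Icc 1 k, sortedVal n w i) / k

/-- `avgHigh n w k = (1/(n-k)) Σ_{i=k+1}^n (1 - w_(i))` (equal to `0` when `k = n`). -/
noncomputable def avgHigh (n : ℕ) (w : Fin n → ℝ) (k : ℕ) : ℝ :=
  (∑ i ∈ Finset.Icc (k + 1) n, (1 - sortedVal n w i)) / ((n : ℝ) - k)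

/-- The greatest convex minorant on `[0,1]` of a function `h`, evaluated at `α`. -/
noncomputable def gcm (h : ℝ → ℝ) (α : ℝ) : ℝ :=
  sSup {y | ∃ C : ℝ → ℝ, ConvexOn ℝ (Set.Icc 0 1) C ∧
    (∀ t ∈ Set.Icc (0 : ℝ) 1, C t ≤ h t) ∧ y = C α}

end TwoGroup

namespace TwoGroup

open Set

section Relaxation

variable {ρ : Measure ℝ} {g : ℝ → ℝ}

lemma aemeasurable_of_monotoneOn_unit (hρ : ∀ᵐ u ∂ρ, u ∈ Icc (0 : ℝ) 1)
    (hg : MonotoneOn g (Icc 0 1)) : AEMeasurable g ρ := by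
  have h := aemeasurable_restrict_of_monotoneOn (μ := ρ) measurableSet_Icc hg
  rwa [Measure.restrict_eq_self_of_ae_mem hρ] at h

lemma aemeasurable_of_antitoneOn_unit (hρ : ∀ᵐ u ∂ρ, u ∈ Icc (0 : ℝ) 1)
    (hg : AntitoneOn g (Icc 0 1)) : AEMeasurable g ρ := by
  have h := aemeasurable_restrict_of_antitoneOn (μ := ρ) measurableSet_Icc hg
  rwa [Measure.restrict_eq_self_of_ae_mem hρ] at h

lemma integrable_of_mapsTo_unit [IsFiniteMeasure ρ] (hρ : ∀ᵐ u ∂ρ, u ∈ Icc (0 : ℝ) 1)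
    (hg : AEMeasurable g ρ) (hmaps : MapsTo g (Icc 0 1) (Icc 0 1)) : Integrable g ρ := by
  refine Integrable.of_bound hg.aestronglyMeasurable 1 ?_
  filter_upwards [hρ] with u hu
  rw [Real.norm_eq_abs, abs_of_nonneg (hmaps hu).1]
  exact (hmaps hu).2

lemma integral_nonneg_of_mapsTo_unit (hρ : ∀ᵐ u ∂ρ, u ∈ Icc (0 : ℝ) 1)
    (hmaps : MapsTo g (Icc 0 1) (Icc 0 1)) : 0 ≤ ∫ u, g u ∂ρ := by
  refine integral_nonneg_of_ae ?_
  filter_upwards [hρ] with u hu using (hmaps hu).1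

lemma ae_map_mem_unit (hρ : ∀ᵐ u ∂ρ, u ∈ Icc (0 : ℝ) 1) (hg : AEMeasurable g ρ)
    (hmaps : MapsTo g (Icc 0 1) (Icc 0 1)) : ∀ᵐ z ∂(ρ.map g), z ∈ Icc (0 : ℝ) 1 := by
  refine (ae_map_iff (p := (· ∈ Icc (0 : ℝ) 1)) hg measurableSet_Icc).2 ?_
  filter_upwards [hρ] with u hu using hmaps hu

/-- Randomizing over `u` at constraint level `α` is equivalent to randomizing over the constraint
level `z`, when the value function `s` at level `z` is attained at `w z`. -/
lemma sInf_relaxation_eq {a b s w : ℝ → ℝ}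
    (ha : MonotoneOn a (Icc 0 1)) (hb : AntitoneOn b (Icc 0 1))
    (ha01 : MapsTo a (Icc 0 1) (Icc 0 1)) (hb01 : MapsTo b (Icc 0 1) (Icc 0 1))
    (ha0 : a 0 = 0) (hw : MonotoneOn w (Icc 0 1)) (hw01 : MapsTo w (Icc 0 1) (Icc 0 1))
    (haw : ∀ z ∈ Icc (0 : ℝ) 1, a (w z) ≤ z) (hs : ∀ z ∈ Icc (0 : ℝ) 1, s z = b (w z))
    (hsa : ∀ u ∈ Icc (0 : ℝ) 1, s (a u) ≤ b u) {α : ℝ} (hα : 0 ≤ α) :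
    sInf {y | ∃ ρ : Measure ℝ, IsProbabilityMeasure ρ ∧ (∀ᵐ u ∂ρ, u ∈ Icc (0 : ℝ) 1) ∧
        (∫ u, a u ∂ρ) ≤ α ∧ y = ∫ u, b u ∂ρ} =
      sInf {y | ∃ ρ : Measure ℝ, IsProbabilityMeasure ρ ∧ (∀ᵐ z ∂ρ, z ∈ Icc (0 : ℝ) 1) ∧
        (∫ z, z ∂ρ) ≤ α ∧ y = ∫ z, s z ∂ρ} := by
  have hs_anti : AntitoneOn s (Icc 0 1) := fun x hx y hy hxy => by
    rw [hs x hx, hs y hy]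
    exact hb (hw01 hx) (hw01 hy) (hw hx hy hxy)
  have hs01 : MapsTo s (Icc 0 1) (Icc 0 1) := fun z hz => by
    rw [hs z hz]
    exact hb01 (hw01 hz)
  have h0 : ∀ᵐ u ∂(Measure.dirac (0 : ℝ)), u ∈ Icc (0 : ℝ) 1 := by
    simp
  apply le_antisymm
  · refine le_csInf ⟨_, Measure.dirac 0, inferInstance, h0, by simpa using hα, rfl⟩ ?_
    rintro _ ⟨ρ, hprob, hρ, hle, rfl⟩
    have hwm := aemeasurable_of_monotoneOn_unit hρ hw
    have hmap := ae_map_mem_unit hρ hwm hw01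
    have := Measure.isProbabilityMeasure_map hwm
    have ham := aemeasurable_of_monotoneOn_unit hmap ha
    have hbm := aemeasurable_of_antitoneOn_unit hmap hb
    refine csInf_le ⟨0, ?_⟩ ⟨ρ.map w, this, hmap, le_trans ?_ hle, ?_⟩
    · rintro _ ⟨ρ', _, hρ', _, rfl⟩
      exact integral_nonneg_of_mapsTo_unit hρ' hb01
    · rw [integral_map hwm ham.aestronglyMeasurable]
      refine integral_mono_ae ?_ ?_ ?_
      · exact integrable_of_mapsTo_unit hρ (ham.comp_aemeasurable hwm) (ha01.comp hw01)
      · exact integrable_of_mapsTo_unit hρ aemeasurable_id fun _ h => h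
      · filter_upwards [hρ] with z hz using haw z hz
    · rw [integral_map hwm hbm.aestronglyMeasurable]
      refine integral_congr_ae ?_
      filter_upwards [hρ] with z hz using hs z hz
  · refine le_csInf ⟨_, Measure.dirac 0, inferInstance, h0, by simpa [ha0] using hα, rfl⟩ ?_
    rintro _ ⟨ρ, hprob, hρ, hle, rfl⟩
    have ham := aemeasurable_of_monotoneOn_unit hρ ha
    have hmap := ae_map_mem_unit hρ ham ha01
    have := Measure.isProbabilityMeasure_map ham
    have hsm := aemeasurable_of_antitoneOn_unit hmap hs_anti
    refine le_trans (csInf_le ⟨0, ?_⟩ ⟨ρ.map a, this, hmap, le_of_eq_of_le ?_ hle, rfl⟩) ?_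
    · rintro _ ⟨ρ', _, hρ', _, rfl⟩
      exact integral_nonneg_of_mapsTo_unit hρ' hs01
    · exact integral_map ham aestronglyMeasurable_id
    · rw [integral_map ham hsm.aestronglyMeasurable]
      refine integral_mono_ae ?_ ?_ ?_
      · exact integrable_of_mapsTo_unit hρ (hsm.comp_aemeasurable ham) (hs01.comp ha01)
      · exact integrable_of_mapsTo_unit hρ (aemeasurable_of_antitoneOn_unit hρ hb) hb01
      · filter_upwards [hρ] with u hu using hsa u hu

end Relaxation

namespace Model

variable {𝒳 : Type*} [MeasurableSpace 𝒳] (M : Model 𝒳)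

lemma π1_pos : 0 < M.π1 := sub_pos.2 M.π0_mem.2

lemma measurable_f : Measurable M.f :=
  (M.f0_meas.const_mul _).add (M.f1_meas.const_mul _)

lemma measurable_Lfdr : Measurable M.Lfdr := (M.f0_meas.const_mul _).div M.measurable_f

lemma Lfdr_mem (x : 𝒳) : M.Lfdr x ∈ Icc (0 : ℝ) 1 := by
  have h0 := mul_nonneg M.π0_mem.1.le (M.f0_nonneg x)
  have h1 := mul_nonneg M.π1_pos.le (M.f1_nonneg x)
  exact ⟨div_nonneg h0 (add_nonneg h0 h1), div_le_one_of_le₀ (by simp [f, h1]) (add_nonneg h0 h1)⟩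

instance isProbabilityMeasure_Pmix : IsProbabilityMeasure M.Pmix := by
  have h0 := M.f0_prob.measure_univ
  have h1 := M.f1_prob.measure_univ
  rw [withDensity_apply _ MeasurableSet.univ, Measure.restrict_univ] at h0 h1
  constructor
  rw [Pmix, withDensity_apply _ MeasurableSet.univ, Measure.restrict_univ]
  have hf : ∀ x, ENNReal.ofReal (M.f x) = ENNReal.ofReal M.π0 * ENNReal.ofReal (M.f0 x) +
      ENNReal.ofReal M.π1 * ENNReal.ofReal (M.f1 x) := fun x => by
    rw [f, ENNReal.ofReal_add (mul_nonneg M.π0_mem.1.le (M.f0_nonneg x))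
      (mul_nonneg M.π1_pos.le (M.f1_nonneg x)), ENNReal.ofReal_mul M.π0_mem.1.le,
      ENNReal.ofReal_mul M.π1_pos.le]
  simp_rw [hf]
  rw [lintegral_add_left (M.f0_meas.ennreal_ofReal.const_mul _),
    lintegral_const_mul _ M.f0_meas.ennreal_ofReal,
    lintegral_const_mul _ M.f1_meas.ennreal_ofReal, h0, h1, mul_one, mul_one,
    ← ENNReal.ofReal_add M.π0_mem.1.le M.π1_pos.le]
  simp [π1]

instance isProbabilityMeasure_νW : IsProbabilityMeasure M.νW :=
  Measure.isProbabilityMeasure_map M.measurable_Lfdr.aemeasurable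

lemma ae_νW_mem : ∀ᵐ w ∂M.νW, w ∈ Icc (0 : ℝ) 1 := by
  exact (ae_map_iff (p := (· ∈ Icc (0 : ℝ) 1)) M.measurable_Lfdr.aemeasurable
    measurableSet_Icc).2 (ae_of_all _ M.Lfdr_mem)

lemma integrable_id_νW : Integrable (fun w => w) M.νW :=
  integrable_of_mapsTo_unit M.ae_νW_mem aemeasurable_id fun _ h => h

lemma G_eq_cdf (t : ℝ) : M.G t = cdf M.νW t := (cdf_eq_real M.νW t).symm

lemma Gbar_add_atom (t : ℝ) : M.Gbar t + M.atom t = M.G t := by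
  have : M.νW.real (Iio t ∪ {t}) = M.νW.real (Iio t) + M.νW.real {t} :=
    measureReal_union (by simp) (measurableSet_singleton t)
  rw [Iio_union_right] at this
  exact this.symm

lemma νW_Iio_zero : M.νW (Iio 0) = 0 := by
  refine measure_mono_null ?_ M.ae_νW_mem
  intro w hw hw'
  exact absurd hw'.1 (not_le.2 hw)

lemma G_of_neg {t : ℝ} (ht : t < 0) : M.G t = 0 := by
  simp [G, measure_mono_null (Iic_subset_Iio.2 ht) M.νW_Iio_zero]

lemma Gbar_zero : M.Gbar 0 = 0 := by
  simp [Gbar, νW_Iio_zero]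

lemma G_one : M.G 1 = 1 := by
  have : M.νW (Iic 1) = 1 := by
    rw [prob_compl_eq_zero_iff measurableSet_Iic |>.symm]
    refine measure_mono_null ?_ M.ae_νW_mem
    intro w hw hw'
    exact hw hw'.2
  simp [G, this]

lemma Ginv_zero : M.Ginv 0 = 0 := by
  have : {t | 0 ≤ M.G t} = univ := eq_univ_of_forall fun t => ENNReal.toReal_nonneg
  rw [Ginv, this, Real.sInf_univ]

lemma bddBelow_Ginv {u : ℝ} (hu : 0 < u) : (0 : ℝ) ∈ lowerBounds {t | u ≤ M.G t} := by
  intro t ht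
  by_contra! h
  rw [mem_ofPred_eq, M.G_of_neg h] at ht
  exact absurd ht (not_le.2 hu)

lemma Ginv_mem {u : ℝ} (hu : u ∈ Icc (0 : ℝ) 1) : M.Ginv u ∈ Icc (0 : ℝ) 1 := by
  rcases hu.1.eq_or_lt with rfl | h
  · simp [Ginv_zero]
  · have h1 : (1 : ℝ) ∈ {t | u ≤ M.G t} := by simpa [G_one] using hu.2
    exact ⟨le_csInf ⟨1, h1⟩ (M.bddBelow_Ginv h), csInf_le ⟨0, M.bddBelow_Ginv h⟩ h1⟩

lemma le_G_Ginv {u : ℝ} (hu : u ∈ Icc (0 : ℝ) 1) : u ≤ M.G (M.Ginv u) := by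
  rcases hu.1.eq_or_lt with rfl | h
  · exact ENNReal.toReal_nonneg
  · have h1 : (1 : ℝ) ∈ {t | u ≤ M.G t} := by simpa [G_one] using hu.2
    have hc : Tendsto M.G (nhdsWithin (M.Ginv u) (Ioi (M.Ginv u))) (nhds (M.G (M.Ginv u))) := by
      rw [show M.G = cdf M.νW from funext M.G_eq_cdf]
      exact continuousWithinAt_Ioi_iff_Ici.2 ((cdf M.νW).right_continuous (M.Ginv u))
    refine ge_of_tendsto hc ?_
    filter_upwards [self_mem_nhdsWithin] with t ht
    obtain ⟨s, hs, hst⟩ := exists_lt_of_csInf_lt ⟨1, h1⟩ (show sInf {t | u ≤ M.G t} < t from ht)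
    exact le_trans hs (measureReal_mono (Iic_subset_Iic.2 hst.le))

lemma Gbar_Ginv_le {u : ℝ} (hu : u ∈ Icc (0 : ℝ) 1) : M.Gbar (M.Ginv u) ≤ u := by
  rcases hu.1.eq_or_lt with rfl | h
  · rw [Ginv_zero, Gbar_zero]
  · have hm : M.Gbar (M.Ginv u) = (cdf M.νW).measure.real (Iio (M.Ginv u)) := by
      rw [measure_cdf]; rfl
    have hl : Function.leftLim (cdf M.νW) (M.Ginv u) ≤ u := by
      refine le_of_tendsto ((cdf M.νW).mono.tendsto_leftLim (M.Ginv u)) ?_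
      filter_upwards [self_mem_nhdsWithin] with t ht
      rw [← M.G_eq_cdf]
      by_contra! hlt
      exact absurd (csInf_le ⟨0, M.bddBelow_Ginv h⟩ hlt.le) (not_le.2 ht)
    rw [hm, Measure.real, StieltjesFunction.measure_Iio _ (tendsto_cdf_atBot M.νW), sub_zero]
    exact ENNReal.toReal_le_of_le_ofReal hu.1 (ENNReal.ofReal_le_ofReal hl)

lemma pu_mul_atom {u : ℝ} (hu : u ∈ Icc (0 : ℝ) 1) :
    M.pu u * M.atom (M.Ginv u) = u - M.Gbar (M.Ginv u) := by
  by_cases h : M.atom (M.Ginv u) = 0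
  · have h1 := M.Gbar_add_atom (M.Ginv u)
    have h2 := M.le_G_Ginv hu
    have h3 := M.Gbar_Ginv_le hu
    rw [h, mul_zero]
    linarith
  · exact div_mul_cancel₀ _ h

/-- The expected shortfall `E[(t - W)⁺]`. -/
noncomputable def shortfall (t : ℝ) : ℝ := ∫ w in Iio t, (t - w) ∂M.νW

/-- The unnormalized numerator `E[W S_u]` of `a(u)`, in Legendre-transform form. -/
noncomputable def lowerMass (u : ℝ) : ℝ := u * M.Ginv u - M.shortfall (M.Ginv u)

lemma integrable_sub_νW (t : ℝ) : Integrable (fun w => t - w) M.νW :=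
  (integrable_const t).sub M.integrable_id_νW

lemma shortfall_eq (t : ℝ) : M.shortfall t = t * M.Gbar t - ∫ w in Iio t, w ∂M.νW := by
  rw [shortfall, integral_sub (integrable_const t) M.integrable_id_νW.integrableOn,
    setIntegral_const, smul_eq_mul, mul_comm]
  rfl

lemma setIntegral_Iio_le_shortfall {c s : ℝ} :
    ∫ w in Iio c, (s - w) ∂M.νW ≤ M.shortfall s := by
  rw [shortfall, ← integral_indicator measurableSet_Iio, ← integral_indicator measurableSet_Iio]
  refine integral_mono ((M.integrable_sub_νW s).indicator measurableSet_Iio)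
    ((M.integrable_sub_νW s).indicator measurableSet_Iio) fun w => ?_
  simp only [indicator_apply, mem_Iio]
  split_ifs <;> linarith

lemma setIntegral_Iic_le_shortfall {c s : ℝ} :
    ∫ w in Iic c, (s - w) ∂M.νW ≤ M.shortfall s := by
  rw [shortfall, ← integral_indicator measurableSet_Iio, ← integral_indicator measurableSet_Iic]
  refine integral_mono ((M.integrable_sub_νW s).indicator measurableSet_Iic)
    ((M.integrable_sub_νW s).indicator measurableSet_Iio) fun w => ?_
  simp only [indicator_apply, mem_Iio, mem_Iic]
  split_ifs <;> linarith

lemma setIntegral_Iic_sub_self (t : ℝ) : ∫ w in Iic t, (t - w) ∂M.νW = M.shortfall t := by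
  rw [shortfall, ← integral_indicator measurableSet_Iio, ← integral_indicator measurableSet_Iic]
  congr 1 with w
  simp only [indicator_apply, mem_Iio, mem_Iic]
  split_ifs <;> linarith

lemma shortfall_sub_ge_Gbar (s t : ℝ) :
    (s - t) * M.Gbar t ≤ M.shortfall s - M.shortfall t := by
  have h : ∫ w in Iio t, (s - w) ∂M.νW = (s - t) * M.Gbar t + M.shortfall t := by
    rw [M.shortfall_eq t, integral_sub (integrable_const s) M.integrable_id_νW.integrableOn,
      setIntegral_const, smul_eq_mul]
    change M.Gbar t * s - _ = _
    ring
  linarith [M.setIntegral_Iio_le_shortfall (c := t) (s := s)]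

lemma shortfall_sub_ge_G (s t : ℝ) :
    (s - t) * M.G t ≤ M.shortfall s - M.shortfall t := by
  have h : ∫ w in Iic t, (s - w) ∂M.νW = (s - t) * M.G t + M.shortfall t := by
    rw [← M.setIntegral_Iic_sub_self t,
      integral_sub (integrable_const s) M.integrable_id_νW.integrableOn,
      integral_sub (integrable_const t) M.integrable_id_νW.integrableOn,
      setIntegral_const, setIntegral_const, smul_eq_mul, smul_eq_mul]
    change M.G t * s - _ = (s - t) * M.G t + (M.G t * t - _)
    ring
  linarith [M.setIntegral_Iic_le_shortfall (c := t) (s := s)]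

lemma le_lowerMass {u : ℝ} (hu : u ∈ Icc (0 : ℝ) 1) (s : ℝ) :
    u * s - M.shortfall s ≤ M.lowerMass u := by
  rw [lowerMass]
  rcases le_total s (M.Ginv u) with h | h
  · have := M.shortfall_sub_ge_Gbar s (M.Ginv u)
    nlinarith [mul_nonneg (sub_nonneg.2 h) (sub_nonneg.2 (M.Gbar_Ginv_le hu))]
  · have := M.shortfall_sub_ge_G s (M.Ginv u)
    nlinarith [mul_nonneg (sub_nonneg.2 h) (sub_nonneg.2 (M.le_G_Ginv hu))]

/-- `G⁻¹(u)` is a subgradient of `lowerMass` at `u`. -/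
lemma lowerMass_subgradient {v : ℝ} (hv : v ∈ Icc (0 : ℝ) 1) (u : ℝ) :
    M.lowerMass u + (v - u) * M.Ginv u ≤ M.lowerMass v := by
  have := M.le_lowerMass hv (M.Ginv u)
  rw [lowerMass]
  linarith

lemma lowerMass_zero : M.lowerMass 0 = 0 := by
  have h : ∫ w in Iio (0 : ℝ), w ∂M.νW = 0 := setIntegral_measure_zero _ M.νW_Iio_zero
  rw [lowerMass, Ginv_zero, shortfall_eq, h]
  ring

lemma lowerMass_one : M.lowerMass 1 = ∫ w, w ∂M.νW := by
  have key : ∀ t, ∫ w, (t - w) ∂M.νW = t - ∫ w, w ∂M.νW := fun t => by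
    rw [integral_sub (integrable_const t) M.integrable_id_νW]
    simp
  apply le_antisymm
  · have h : ∫ w, (M.Ginv 1 - w) ∂M.νW ≤ M.shortfall (M.Ginv 1) := by
      rw [← M.setIntegral_Iic_sub_self, setIntegral_eq_integral_of_ae_compl_eq_zero]
      have h1 := M.le_G_Ginv (u := 1) (by simp)
      have h2 : M.νW (Iic (M.Ginv 1))ᶜ = 0 := by
        rw [prob_compl_eq_zero_iff measurableSet_Iic]
        exact le_antisymm prob_le_one (ENNReal.one_le_ofReal.2 h1 |>.trans ENNReal.ofReal_toReal_le)
      have h3 : ∀ᵐ w ∂M.νW, w ∈ Iic (M.Ginv 1) := h2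
      filter_upwards [h3] with w hw hw'
      exact absurd hw hw'
    rw [key] at h
    rw [lowerMass]
    linarith
  · have h := M.le_lowerMass (u := 1) (by simp) 1
    have h' : M.shortfall 1 = ∫ w, (1 - w) ∂M.νW := by
      rw [← M.setIntegral_Iic_sub_self, setIntegral_eq_integral_of_ae_compl_eq_zero]
      filter_upwards [M.ae_νW_mem] with w hw hw'
      exact absurd hw.2 hw'
    rw [h', key] at h
    linarith

lemma a_zero : M.a 0 = 0 := if_pos rfl

lemma a_mul_self {u : ℝ} (hu : u ∈ Icc (0 : ℝ) 1) : u * M.a u = M.lowerMass u := by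
  rcases eq_or_ne u 0 with rfl | h
  · rw [lowerMass_zero, zero_mul]
  · rw [a, if_neg h, mul_div_cancel₀ _ h, lowerMass, shortfall_eq]
    linear_combination M.Ginv u * M.pu_mul_atom hu

lemma b_one : M.b 1 = 0 := if_pos rfl

lemma b_mul_one_sub {u : ℝ} (hu : u ∈ Icc (0 : ℝ) 1) :
    (1 - u) * M.b u = 1 - u - M.lowerMass 1 + M.lowerMass u := by
  rcases eq_or_ne u 1 with rfl | h
  · rw [b_one]
    ring
  · rw [b, if_neg h, mul_div_cancel₀ _ (sub_ne_zero.2 h.symm)]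
    set t := M.Ginv u
    have h1 : ∫ w in Ioi t, (1 - w) ∂M.νW =
        ∫ w, (1 - w) ∂M.νW - ∫ w in Iic t, (1 - w) ∂M.νW := by
      rw [← integral_add_compl measurableSet_Iic (M.integrable_sub_νW 1), compl_Iic]
      ring
    have h2 : ∫ w in Iic t, (1 - w) ∂M.νW = (1 - t) * M.G t + M.shortfall t := by
      rw [← M.setIntegral_Iic_sub_self t,
        integral_sub (integrable_const 1) M.integrable_id_νW.integrableOn,
        integral_sub (integrable_const t) M.integrable_id_νW.integrableOn,
        setIntegral_const, setIntegral_const, smul_eq_mul, smul_eq_mul]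
      change M.G t * 1 - _ = (1 - t) * M.G t + (M.G t * t - _)
      ring
    have h3 : ∫ w, (1 - w) ∂M.νW = 1 - ∫ w, w ∂M.νW := by
      rw [integral_sub (integrable_const 1) M.integrable_id_νW]
      simp
    rw [h1, h2, h3, lowerMass_one, lowerMass, ← M.Gbar_add_atom t]
    linear_combination (t - 1) * M.pu_mul_atom hu

lemma a_le_Ginv {u : ℝ} (hu : u ∈ Icc (0 : ℝ) 1) : M.a u ≤ M.Ginv u := by
  rcases hu.1.eq_or_lt with rfl | h
  · rw [a_zero, Ginv_zero]
  · have h1 := M.lowerMass_subgradient (v := 0) (by simp) u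
    rw [lowerMass_zero, ← M.a_mul_self hu] at h1
    exact le_of_mul_le_mul_left (by linarith) h

lemma a_mem {u : ℝ} (hu : u ∈ Icc (0 : ℝ) 1) : M.a u ∈ Icc (0 : ℝ) 1 := by
  refine ⟨?_, (M.a_le_Ginv hu).trans (M.Ginv_mem hu).2⟩
  rcases hu.1.eq_or_lt with rfl | h
  · rw [a_zero]
  · have h1 := M.lowerMass_subgradient hu 0
    rw [lowerMass_zero, Ginv_zero, ← M.a_mul_self hu] at h1
    exact nonneg_of_mul_nonneg_right (by linarith) h

lemma a_monotoneOn : MonotoneOn M.a (Icc 0 1) := by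
  intro u hu v hv huv
  rcases hu.1.eq_or_lt with rfl | h
  · rw [a_zero]
    exact (M.a_mem hv).1
  · have hv0 : 0 < v := h.trans_le huv
    have h1 := M.lowerMass_subgradient hv u
    have h3 := M.a_le_Ginv hu
    rw [← M.a_mul_self hu, ← M.a_mul_self hv] at h1
    refine le_of_mul_le_mul_left ?_ hv0
    nlinarith [mul_nonneg (sub_nonneg.2 huv) (sub_nonneg.2 h3)]

lemma b_le_one_sub_Ginv {u : ℝ} (hu : u ∈ Icc (0 : ℝ) 1) : M.b u ≤ 1 - M.Ginv u := by
  rcases hu.2.eq_or_lt with rfl | h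
  · rw [b_one]
    exact sub_nonneg.2 (M.Ginv_mem hu).2
  · have h1 := M.lowerMass_subgradient (v := 1) (by simp) u
    have h2 := M.b_mul_one_sub hu
    refine le_of_mul_le_mul_left ?_ (sub_pos.2 h)
    linarith

lemma b_mem {u : ℝ} (hu : u ∈ Icc (0 : ℝ) 1) : M.b u ∈ Icc (0 : ℝ) 1 := by
  refine ⟨?_, (M.b_le_one_sub_Ginv hu).trans (sub_le_self _ (M.Ginv_mem hu).1)⟩
  rcases hu.2.eq_or_lt with rfl | h
  · rw [b_one]
  · have h1 := M.lowerMass_subgradient hu 1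
    have h2 := M.b_mul_one_sub hu
    refine nonneg_of_mul_nonneg_right ?_ (sub_pos.2 h)
    nlinarith [mul_nonneg (sub_nonneg.2 h.le)
      (sub_nonneg.2 (M.Ginv_mem (u := 1) (by simp)).2)]

lemma b_antitoneOn : AntitoneOn M.b (Icc 0 1) := by
  intro u hu v hv huv
  rcases hv.2.eq_or_lt with rfl | h
  · rw [b_one]
    exact (M.b_mem hu).1
  · have hu1 : u < 1 := huv.trans_lt h
    have h1 := M.lowerMass_subgradient hu v
    have h3 := M.b_le_one_sub_Ginv hv
    have h4 := M.b_mul_one_sub hu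
    have h5 := M.b_mul_one_sub hv
    refine le_of_mul_le_mul_left ?_ (sub_pos.2 hu1)
    nlinarith [mul_nonneg (sub_nonneg.2 huv) (sub_nonneg.2 h3)]

lemma a_le_of_forall_lt {u z : ℝ} (hu : u ∈ Icc (0 : ℝ) 1) (hz : 0 ≤ z)
    (h : ∀ v ∈ Ico 0 u, M.a v ≤ z) : M.a u ≤ z := by
  rcases hu.1.eq_or_lt with rfl | hpos
  · rwa [a_zero]
  have key : ∀ v ∈ Ico 0 u, M.lowerMass u ≤ v * z + (u - v) := fun v hv => by
    have hv' : v ∈ Icc (0 : ℝ) 1 := ⟨hv.1, hv.2.le.trans hu.2⟩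
    have h1 := M.lowerMass_subgradient hv' u
    rw [← M.a_mul_self hv'] at h1
    nlinarith [mul_le_mul_of_nonneg_left (h v hv) hv.1,
      mul_nonneg (sub_nonneg.2 hv.2.le) (sub_nonneg.2 (M.Ginv_mem hu).2)]
  have hlim : Tendsto (fun v : ℝ => v * z + (u - v)) (nhdsWithin u (Iio u)) (nhds (u * z)) := by
    have : Continuous fun v : ℝ => v * z + (u - v) := by fun_prop
    simpa using (this.tendsto u).mono_left nhdsWithin_le_nhds
  have hle : M.lowerMass u ≤ u * z := by
    refine ge_of_tendsto hlim ?_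
    filter_upwards [Ico_mem_nhdsLT hpos] with v hv using key v hv
  rw [← M.a_mul_self hu] at hle
  exact le_of_mul_le_mul_left hle hpos

lemma bddAbove_ustar (z : ℝ) : (1 : ℝ) ∈ upperBounds {u | u ∈ Icc (0 : ℝ) 1 ∧ M.a u ≤ z} :=
  fun _ hu => hu.1.2

lemma zero_mem_ustar {z : ℝ} (hz : 0 ≤ z) :
    (0 : ℝ) ∈ {u | u ∈ Icc (0 : ℝ) 1 ∧ M.a u ≤ z} := by
  simpa [a_zero] using hz

lemma ustar_mem {z : ℝ} (hz : 0 ≤ z) : M.ustar z ∈ Icc (0 : ℝ) 1 :=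
  ⟨le_csSup ⟨1, M.bddAbove_ustar z⟩ (M.zero_mem_ustar hz),
    csSup_le ⟨0, M.zero_mem_ustar hz⟩ (M.bddAbove_ustar z)⟩

lemma ustar_monotoneOn : MonotoneOn M.ustar (Icc 0 1) := fun _ hx y _ hxy =>
  csSup_le_csSup ⟨1, M.bddAbove_ustar y⟩ ⟨0, M.zero_mem_ustar hx.1⟩
    fun _ hu => ⟨hu.1, hu.2.trans hxy⟩

lemma a_ustar_le {z : ℝ} (hz : 0 ≤ z) : M.a (M.ustar z) ≤ z := by
  refine M.a_le_of_forall_lt (M.ustar_mem hz) hz fun v hv => ?_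
  obtain ⟨u, hu, hvu⟩ := exists_lt_of_lt_csSup ⟨0, M.zero_mem_ustar hz⟩ hv.2
  exact (M.a_monotoneOn ⟨hv.1, hvu.le.trans hu.1.2⟩ hu.1 hvu.le).trans hu.2

lemma bstar_le {u z : ℝ} (hu : u ∈ Icc (0 : ℝ) 1) (h : M.a u ≤ z) : M.bstar z ≤ M.b u := by
  refine csInf_le ⟨0, ?_⟩ ⟨u, hu, h, rfl⟩
  rintro _ ⟨v, hv, _, rfl⟩
  exact (M.b_mem hv).1

lemma bstar_eq_b_ustar {z : ℝ} (hz : 0 ≤ z) : M.bstar z = M.b (M.ustar z) := by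
  have hmem := M.ustar_mem hz
  refine le_antisymm (M.bstar_le hmem (M.a_ustar_le hz))
    (le_csInf ⟨_, _, hmem, M.a_ustar_le hz, rfl⟩ ?_)
  rintro _ ⟨v, hv, hav, rfl⟩
  exact M.b_antitoneOn hv hmem (le_csSup ⟨1, M.bddAbove_ustar z⟩ ⟨hv, hav⟩)

end Model

end TwoGroup

namespace TwoGroup

/-- **Equivalent formulation of `b**`**. For every `α ∈ [0,1]`,
`b**(α) = inf{E[b*(Z)] : Z a [0,1]-valued random variable with E[Z] ≤ α}`. -/
theorem bstarstar_eq_inf_bstar {𝒳 : Type*} [MeasurableSpace 𝒳] (M : Model 𝒳) :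
    ∀ α ∈ Set.Icc (0 : ℝ) 1,
      M.bstarstar α =
        sInf {y | ∃ ρ : MeasureTheory.Measure ℝ, MeasureTheory.IsProbabilityMeasure ρ ∧
          (∀ᵐ z ∂ρ, z ∈ Set.Icc (0 : ℝ) 1) ∧ (∫ z, z ∂ρ) ≤ α ∧
          y = ∫ z, M.bstar z ∂ρ} := fun _ hα =>
  sInf_relaxation_eq M.a_monotoneOn M.b_antitoneOn (fun _ => M.a_mem) (fun _ => M.b_mem)
    M.a_zero M.ustar_monotoneOn (fun _ hz => M.ustar_mem hz.1) (fun _ hz => M.a_ustar_le hz.1)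
    (fun _ hz => M.bstar_eq_b_ustar hz.1) (fun _ hu => M.bstar_le hu le_rfl) hα.1

end TwoGroup
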